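/- arXiv:2005.05064 — 10 statements merged into one kernel-verified Lean document; each statement's English description precedes it below -/
import Mathlib

section
/- Let (l, r, V) be a bimodule of an anti-flexible algebra (A, ·) over a field F of characteristic ≠ 2. Then (l − r, V) is a representation of the associated Lie algebra g(A) with bracket [x, y] = x·y − y·x; that is, (l − r)([x, y]) = (l − r)(x)(l − r)(y) − (l − r)(y)(l − r)(x) for all x, y ∈ A. -/
open LinearMap

def IsAntiFlexible {F : Type*} [Field F] {A : Type*} [AddCommGroup A] [Module F A]
    (m : A →ₗ[F] A →ₗ[F] A) : Prop :=
  ∀ x y z : A, m (m x y) z - m x (m y z) = m (m z y) x - m z (m y x)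

def IsAntiFlexibleBimodule {F : Type*} [Field F] {A : Type*} [AddCommGroup A] [Module F A]
    {V : Type*} [AddCommGroup V] [Module F V]
    (m : A →ₗ[F] A →ₗ[F] A) (l r : A →ₗ[F] V →ₗ[F] V) : Prop :=
  (∀ x y : A, l (m x y) - l x ∘ₗ l y = r x ∘ₗ r y - r (m y x)) ∧
  (∀ x y : A, l x ∘ₗ r y - r y ∘ₗ l x = l y ∘ₗ r x - r x ∘ₗ l y)

/-- if `(l, r, V)` is a bimodule of an anti-flexible algebra `(A, ·)`,
then `l − r` is a representation of the associated Lie algebra `g(A)` with bracket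
`[x, y] = x·y − y·x`. -/
theorem sub_of_bimodule_is_lie_representation
    {F : Type*} [Field F] {A : Type*} [AddCommGroup A] [Module F A]
    {V : Type*} [AddCommGroup V] [Module F V]
    (hchar : (2 : F) ≠ 0)
    (m : A →ₗ[F] A →ₗ[F] A) (hm : IsAntiFlexible m)
    (l r : A →ₗ[F] V →ₗ[F] V) (hlr : IsAntiFlexibleBimodule m l r) :
    ∀ x y : A,
      (l - r) (m x y - m y x) =
        ((l - r) x) ∘ₗ ((l - r) y) - ((l - r) y) ∘ₗ ((l - r) x) := by
  intro x y
  have hxy := hlr.1 x y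
  have hyx := hlr.1 y x
  have hcomm := hlr.2 x y
  simp only [map_sub, LinearMap.sub_apply, LinearMap.sub_comp, LinearMap.comp_sub]
  linear_combination (norm := module) hxy - hyx + hcomm
end

section
/- Let (l, r, V) be a bimodule of an anti-flexible algebra (A, ·) over a field F of characteristic ≠ 2. Then (r*, l*, V*) is a bimodule of (A, ·), where V* is the dual space of V. -/
open LinearMap Module

/-- The dual of a family of operators: `⟨α*(x)u*, v⟩ = ⟨u*, α(x)v⟩`. -/
def dualFamily {F : Type*} [Field F] {A : Type*} [AddCommGroup A] [Module F A]
    {V : Type*} [AddCommGroup V] [Module F V] (α : A →ₗ[F] V →ₗ[F] V) :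
    A →ₗ[F] Dual F V →ₗ[F] Dual F V :=
  (Module.Dual.transpose (R := F)) ∘ₗ α

/-- if `(l, r, V)` is a bimodule of an anti-flexible algebra `(A, ·)`,
then `(r*, l*, V*)` is a bimodule of `(A, ·)`. -/
theorem dual_bimodule_of_antiFlexible_bimodule
    {F : Type*} [Field F] {A : Type*} [AddCommGroup A] [Module F A]
    {V : Type*} [AddCommGroup V] [Module F V]
    (hchar : (2 : F) ≠ 0)
    (m : A →ₗ[F] A →ₗ[F] A) (hm : IsAntiFlexible m)
    (l r : A →ₗ[F] V →ₗ[F] V) (hlr : IsAntiFlexibleBimodule m l r) :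
    IsAntiFlexibleBimodule m (dualFamily r) (dualFamily l) := by
  refine ⟨fun x y => ?_, fun x y => ?_⟩ <;> ext f v
  · have h := congrArg f (LinearMap.congr_fun (hlr.1 y x) v)
    simp only [LinearMap.sub_apply, LinearMap.comp_apply, map_sub] at h
    simp only [dualFamily, LinearMap.sub_apply, LinearMap.comp_apply, Module.Dual.transpose_apply]
    linear_combination h
  · have h := congrArg f (LinearMap.congr_fun (hlr.2 x y) v)
    simp only [LinearMap.sub_apply, LinearMap.comp_apply, map_sub] at h
    simp only [dualFamily, LinearMap.sub_apply, LinearMap.comp_apply, Module.Dual.transpose_apply]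
    linear_combination -h
end

section
/- Let (A, ·) be a finite-dimensional anti-flexible algebra over a field F of characteristic ≠ 2 equipped with a nondegenerate symmetric invariant bilinear form 𝔅 (i.e., 𝔅(x·y, z) = 𝔅(x, y·z) for all x, y, z ∈ A). Then the bimodules (L, R, A) and (R*, L*, A*) of (A, ·) are equivalent; explicitly, the linear isomorphism φ : A → A* defined by ⟨φ(x), y⟩ = 𝔅(x, y) satisfies φ ∘ L(x) = R*(x) ∘ φ and φ ∘ R(x) = L*(x) ∘ φ for all x ∈ A. -/
open LinearMap Module

/-- if a finite-dimensional anti-flexible algebra `(A, ·)` carries a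
nondegenerate symmetric invariant bilinear form `𝔅`, then the regular bimodule
`(L, R, A)` is equivalent to the dual bimodule `(R*, L*, A*)` via the linear
isomorphism `φ : A → A*`, `⟨φ(x), y⟩ = 𝔅(x, y)`; explicitly, `φ` is bijective and
`φ ∘ L(x) = R*(x) ∘ φ` and `φ ∘ R(x) = L*(x) ∘ φ` for all `x ∈ A`. -/
theorem regular_bimodule_equiv_dual_of_invariant_form
    {F : Type*} [Field F] {A : Type*} [AddCommGroup A] [Module F A]
    [FiniteDimensional F A]
    (hchar : (2 : F) ≠ 0)
    (m : A →ₗ[F] A →ₗ[F] A) (hm : IsAntiFlexible m)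
    (B : A →ₗ[F] A →ₗ[F] F)
    (hsymm : ∀ x y : A, B x y = B y x)
    (hnondeg : ∀ x : A, (∀ y : A, B x y = 0) → x = 0)
    (hinv : ∀ x y z : A, B (m x y) z = B x (m y z)) :
    Function.Bijective (B : A → Dual F A) ∧
    (∀ x : A, (B : A →ₗ[F] Dual F A) ∘ₗ m x = (m.flip x).dualMap ∘ₗ B) ∧
    (∀ x : A, (B : A →ₗ[F] Dual F A) ∘ₗ m.flip x = (m x).dualMap ∘ₗ B) := by
  have hinj : Function.Injective B := by
    refine (injective_iff_map_eq_zero B).2 fun x hx => hnondeg x fun y => ?_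
    rw [hx, LinearMap.zero_apply]
  refine ⟨⟨hinj, (LinearMap.injective_iff_surjective_of_finrank_eq_finrank
    (Subspace.dual_finrank_eq (K := F) (V := A)).symm).1 hinj⟩, fun x => ?_, fun x => ?_⟩
  · ext a y
    change B (m x a) y = B a (m y x)
    rw [hsymm, ← hinv, hsymm]
  · ext a y
    exact hinv a x y
end

section
/- Let (A, Δ) be a finite-dimensional anti-flexible bialgebra over a field F of characteristic ≠ 2. Then δ := Δ − σΔ is a Lie bialgebra structure on the associated Lie algebra g(A) (with bracket [x, y] = x·y − y·x); that is, δ* : A*⊗A* → A* defines a Lie algebra structure on A*, and δ satisfies the 1-cocycle condition δ([x, y]) = (ad(x) ⊗ id + id ⊗ ad(x))δ(y) − (ad(y) ⊗ id + id ⊗ ad(y))δ(x) for all x, y ∈ A, where ad(x)(y) = [x, y]. -/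
open LinearMap Module TensorProduct

/-- The product on `A*` induced by a comultiplication `Δ : A → A ⊗ A`:
`⟨a ∘ b, x⟩ = ⟨a ⊗ b, Δ(x)⟩`. -/
noncomputable def dualProd {F : Type*} [Field F] {A : Type*} [AddCommGroup A] [Module F A]
    (Δ : A →ₗ[F] A ⊗[F] A) : Dual F A →ₗ[F] Dual F A →ₗ[F] Dual F A :=
  TensorProduct.curry (Δ.dualMap ∘ₗ TensorProduct.dualDistrib F A A)

/-- Condition (i) of an anti-flexible bialgebra. -/
def BialgCondI {F : Type*} [Field F] {A : Type*} [AddCommGroup A] [Module F A]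
    (m : A →ₗ[F] A →ₗ[F] A) (Δ : A →ₗ[F] A ⊗[F] A) : Prop :=
  ∀ x y : A,
    Δ (m x y) + TensorProduct.comm F A A (Δ (m y x)) =
      TensorProduct.comm F A A (TensorProduct.map LinearMap.id (m y) (Δ x))
        + TensorProduct.map (m.flip y) LinearMap.id (Δ x)
        + TensorProduct.comm F A A (TensorProduct.map (m.flip x) LinearMap.id (Δ y))
        + TensorProduct.map LinearMap.id (m x) (Δ y)

/-- Condition (ii) of an anti-flexible bialgebra. -/
def BialgCondII {F : Type*} [Field F] {A : Type*} [AddCommGroup A] [Module F A]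
    (m : A →ₗ[F] A →ₗ[F] A) (Δ : A →ₗ[F] A ⊗[F] A) : Prop :=
  ∀ x y : A,
    TensorProduct.comm F A A (TensorProduct.map LinearMap.id (m.flip y) (Δ x))
        - TensorProduct.map LinearMap.id (m.flip y) (Δ x)
        - TensorProduct.comm F A A (TensorProduct.map (m y) LinearMap.id (Δ x))
        + TensorProduct.map (m y) LinearMap.id (Δ x) =
      TensorProduct.comm F A A (TensorProduct.map LinearMap.id (m.flip x) (Δ y))
        - TensorProduct.map LinearMap.id (m.flip x) (Δ y)
        - TensorProduct.comm F A A (TensorProduct.map (m x) LinearMap.id (Δ y))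
        + TensorProduct.map (m x) LinearMap.id (Δ y)

theorem dualDistrib_comm {F : Type*} [Field F] {A : Type*} [AddCommGroup A] [Module F A]
    (a b : Dual F A) (t : A ⊗[F] A) :
    dualDistrib F A A (a ⊗ₜ b) (TensorProduct.comm F A A t) = dualDistrib F A A (b ⊗ₜ a) t := by
  induction t with
  | zero => simp
  | tmul x y => simp [mul_comm]
  | add s t hs ht => simp only [map_add, hs, ht]

/-- The product dual to `Δ - σΔ` is the commutator of the product dual to `Δ`. -/
theorem dualProd_sub_comm {F : Type*} [Field F] {A : Type*} [AddCommGroup A] [Module F A]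
    (Δ : A →ₗ[F] A ⊗[F] A) (a b : Dual F A) :
    dualProd (Δ - (TensorProduct.comm F A A).toLinearMap ∘ₗ Δ) a b =
      dualProd Δ a b - dualProd Δ b a := by
  ext x
  simp [_root_.dualProd, dualDistrib_comm, -dualDistrib_apply]

theorem comm_map_apply {F : Type*} [Field F] {A : Type*} [AddCommGroup A] [Module F A]
    (f g : A →ₗ[F] A) (t : A ⊗[F] A) :
    TensorProduct.comm F A A (TensorProduct.map f g t) =
      TensorProduct.map g f (TensorProduct.comm F A A t) := by
  induction t with
  | zero => simp
  | tmul x y => simp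
  | add s t hs ht => simp only [map_add, hs, ht]

theorem map_sub_left_apply {F : Type*} [Field F] {A : Type*} [AddCommGroup A] [Module F A]
    (f g h : A →ₗ[F] A) (t : A ⊗[F] A) :
    TensorProduct.map (f - g) h t = TensorProduct.map f h t - TensorProduct.map g h t := by
  rw [← LinearMap.sub_apply]
  congr 1
  ext x y
  simp [sub_tmul]

theorem map_sub_right_apply {F : Type*} [Field F] {A : Type*} [AddCommGroup A] [Module F A]
    (f g h : A →ₗ[F] A) (t : A ⊗[F] A) :
    TensorProduct.map f (g - h) t = TensorProduct.map f g t - TensorProduct.map f h t := by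
  rw [← LinearMap.sub_apply]
  congr 1
  ext x y
  simp [tmul_sub]

/-- The commutator of an anti-flexible product satisfies the Jacobi identity. -/
theorem IsAntiFlexible.jacobi {F : Type*} [Field F] {A : Type*} [AddCommGroup A] [Module F A]
    {m : A →ₗ[F] A →ₗ[F] A} (hm : IsAntiFlexible m) (x y z : A) :
    (m (m x y - m y x) z - m z (m x y - m y x))
      + (m (m y z - m z y) x - m x (m y z - m z y))
      + (m (m z x - m x z) y - m y (m z x - m x z)) = 0 := by
  simp only [map_sub, LinearMap.sub_apply]
  linear_combination (norm := module) hm x y z + hm y z x + hm z x y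

/-- Conditions (i) and (ii) make `Δ - σΔ` a `1`-cocycle for the adjoint action. -/
theorem cocycle_of_bialgCond {F : Type*} [Field F] {A : Type*} [AddCommGroup A] [Module F A]
    {m : A →ₗ[F] A →ₗ[F] A} {Δ : A →ₗ[F] A ⊗[F] A}
    (h1 : BialgCondI m Δ) (h2 : BialgCondII m Δ) (x y : A) :
    (Δ - (TensorProduct.comm F A A).toLinearMap ∘ₗ Δ) (m x y - m y x) =
      ((TensorProduct.map (m x - m.flip x) LinearMap.id
          + TensorProduct.map LinearMap.id (m x - m.flip x) :
            A ⊗[F] A →ₗ[F] A ⊗[F] A))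
        ((Δ - (TensorProduct.comm F A A).toLinearMap ∘ₗ Δ) y)
      - ((TensorProduct.map (m y - m.flip y) LinearMap.id
          + TensorProduct.map LinearMap.id (m y - m.flip y) :
            A ⊗[F] A →ₗ[F] A ⊗[F] A))
        ((Δ - (TensorProduct.comm F A A).toLinearMap ∘ₗ Δ) x) := by
  have hxy := h1 x y
  have hyx := h1 y x
  have h := h2 x y
  simp only [comm_map_apply] at hxy hyx h
  simp only [LinearMap.sub_apply, LinearMap.add_apply, LinearMap.comp_apply,
    LinearEquiv.coe_coe, map_sub, map_sub_left_apply, map_sub_right_apply]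
  linear_combination (norm := module) hxy - hyx + h

/-- an anti-flexible bialgebra `(A, Δ)` induces a Lie bialgebra on the
associated Lie algebra `g(A)` via `δ = Δ − σΔ`: the dual of `δ` is a Lie bracket on
`A*`, and `δ` satisfies the `1`-cocycle condition with respect to `ad`. -/
theorem antiFlexibleBialgebra_gives_lieBialgebra
    {F : Type*} [Field F] {A : Type*} [AddCommGroup A] [Module F A]
    [FiniteDimensional F A]
    (hchar : (2 : F) ≠ 0)
    (m : A →ₗ[F] A →ₗ[F] A) (hm : IsAntiFlexible m)
    (Δ : A →ₗ[F] A ⊗[F] A)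
    (hdual : IsAntiFlexible (dualProd Δ))
    (h1 : BialgCondI m Δ) (h2 : BialgCondII m Δ) :
    (∀ a : Dual F A,
      dualProd (Δ - (TensorProduct.comm F A A).toLinearMap ∘ₗ Δ) a a = 0) ∧
    (∀ a b c : Dual F A,
      dualProd (Δ - (TensorProduct.comm F A A).toLinearMap ∘ₗ Δ)
          (dualProd (Δ - (TensorProduct.comm F A A).toLinearMap ∘ₗ Δ) a b) c
        + dualProd (Δ - (TensorProduct.comm F A A).toLinearMap ∘ₗ Δ)
          (dualProd (Δ - (TensorProduct.comm F A A).toLinearMap ∘ₗ Δ) b c) a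
        + dualProd (Δ - (TensorProduct.comm F A A).toLinearMap ∘ₗ Δ)
          (dualProd (Δ - (TensorProduct.comm F A A).toLinearMap ∘ₗ Δ) c a) b = 0) ∧
    (∀ x y : A,
      (Δ - (TensorProduct.comm F A A).toLinearMap ∘ₗ Δ) (m x y - m y x) =
        ((TensorProduct.map (m x - m.flip x) LinearMap.id
            + TensorProduct.map LinearMap.id (m x - m.flip x) :
              A ⊗[F] A →ₗ[F] A ⊗[F] A))
          ((Δ - (TensorProduct.comm F A A).toLinearMap ∘ₗ Δ) y)
        - ((TensorProduct.map (m y - m.flip y) LinearMap.id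
            + TensorProduct.map LinearMap.id (m y - m.flip y) :
              A ⊗[F] A →ₗ[F] A ⊗[F] A))
          ((Δ - (TensorProduct.comm F A A).toLinearMap ∘ₗ Δ) x)) := by
  refine ⟨fun a => ?_, fun a b c => ?_, cocycle_of_bialgCond h1 h2⟩
  · rw [dualProd_sub_comm, sub_self]
  · simp only [dualProd_sub_comm]
    exact hdual.jacobi a b c
end

section
/- Let (A, ·) be an anti-flexible algebra over a field F of characteristic ≠ 2, let r ∈ A⊗A, and define Δ : A → A⊗A by Δ(x) = (id ⊗ L(x))r + (R(x) ⊗ id)σr. Then: (a) the identity Δ(x·y) + σΔ(y·x) = (σ(id ⊗ L(y)) + R(y) ⊗ id)Δ(x) + (σ(R(x) ⊗ id) + id ⊗ L(x))Δ(y) holds for all x, y ∈ A if and only if (L(x) ⊗ R(y) + R(x) ⊗ L(y))(r + σr) = 0 for all x, y ∈ A; and (b) the identity (σ(id ⊗ R(y)) − id ⊗ R(y) − σ(L(y) ⊗ id) + L(y) ⊗ id)Δ(x) = (σ(id ⊗ R(x)) − id ⊗ R(x) − σ(L(x) ⊗ id) + L(x) ⊗ id)Δ(y) holds for all x, y ∈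 A if and only if (R(x) ⊗ R(y) − R(y) ⊗ R(x) + L(x) ⊗ L(y) − L(y) ⊗ L(x))(r + σr) = 0 for all x, y ∈ A. -/
open LinearMap Module TensorProduct

/-- The coboundary comultiplication `Δ(x) = (id ⊗ L(x))r + (R(x) ⊗ id)σr`. -/
noncomputable def coboundaryDelta {F : Type*} [Field F] {A : Type*} [AddCommGroup A]
    [Module F A] (m : A →ₗ[F] A →ₗ[F] A) (r : A ⊗[F] A) : A →ₗ[F] A ⊗[F] A :=
  (LinearMap.applyₗ r ∘ₗ LinearMap.lTensorHom A) ∘ₗ m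
    + (LinearMap.applyₗ (TensorProduct.comm F A A r) ∘ₗ LinearMap.rTensorHom A) ∘ₗ m.flip

section CoboundaryDelta

variable {F : Type*} [Field F] {A : Type*} [AddCommGroup A] [Module F A]
  (m : A →ₗ[F] A →ₗ[F] A)

lemma coboundaryDelta_apply (r : A ⊗[F] A) (x : A) :
    coboundaryDelta m r x = TensorProduct.map LinearMap.id (m x) r
      + TensorProduct.map (m.flip x) LinearMap.id (TensorProduct.comm F A A r) :=
  rfl

variable {m}

/-- The defect of condition (i) for a coboundary comultiplication. -/
lemma coboundaryDelta_defect_condI (hm : IsAntiFlexible m) (r : A ⊗[F] A) (x y : A) :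
    TensorProduct.comm F A A
          (TensorProduct.map LinearMap.id (m y) (coboundaryDelta m r x))
        + TensorProduct.map (m.flip y) LinearMap.id (coboundaryDelta m r x)
        + TensorProduct.comm F A A
          (TensorProduct.map (m.flip x) LinearMap.id (coboundaryDelta m r y))
        + TensorProduct.map LinearMap.id (m x) (coboundaryDelta m r y)
        - (coboundaryDelta m r (m x y)
          + TensorProduct.comm F A A (coboundaryDelta m r (m y x))) =
      (TensorProduct.map (m y) (m.flip x) + TensorProduct.map (m.flip y) (m x) :
          A ⊗[F] A →ₗ[F] A ⊗[F] A)
        (r + TensorProduct.comm F A A r) := by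
  simp only [coboundaryDelta_apply, LinearMap.add_apply, map_add]
  induction r using TensorProduct.induction_on with
  | zero => simp
  | tmul a b =>
    simp only [map_tmul, comm_tmul, id_apply, flip_apply]
    have h₁ := congrArg (fun t => a ⊗ₜ[F] t) (hm x y b)
    have h₂ := congrArg (fun t => t ⊗ₜ[F] a) (hm y x b)
    simp only [tmul_sub, sub_tmul] at h₁ h₂
    linear_combination (norm := abel) -h₁ - h₂
  | add r s hr hs =>
    simp only [map_add]
    linear_combination (norm := abel) hr + hs

/-- The defect of condition (ii) for a coboundary comultiplication. -/
lemma coboundaryDelta_defect_condII (hm : IsAntiFlexible m) (r : A ⊗[F] A) (x y : A) :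
    TensorProduct.comm F A A
          (TensorProduct.map LinearMap.id (m.flip x) (coboundaryDelta m r y))
        - TensorProduct.map LinearMap.id (m.flip x) (coboundaryDelta m r y)
        - TensorProduct.comm F A A
          (TensorProduct.map (m x) LinearMap.id (coboundaryDelta m r y))
        + TensorProduct.map (m x) LinearMap.id (coboundaryDelta m r y)
        - (TensorProduct.comm F A A
            (TensorProduct.map LinearMap.id (m.flip y) (coboundaryDelta m r x))
          - TensorProduct.map LinearMap.id (m.flip y) (coboundaryDelta m r x)
          - TensorProduct.comm F A A
            (TensorProduct.map (m y) LinearMap.id (coboundaryDelta m r x))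
          + TensorProduct.map (m y) LinearMap.id (coboundaryDelta m r x)) =
      (TensorProduct.map (m.flip x) (m.flip y) - TensorProduct.map (m.flip y) (m.flip x)
          + TensorProduct.map (m x) (m y) - TensorProduct.map (m y) (m x) :
          A ⊗[F] A →ₗ[F] A ⊗[F] A)
        (r + TensorProduct.comm F A A r) := by
  simp only [coboundaryDelta_apply, LinearMap.add_apply, LinearMap.sub_apply, map_add]
  induction r using TensorProduct.induction_on with
  | zero => simp
  | tmul a b =>
    simp only [map_tmul, comm_tmul, id_apply, flip_apply]
    have h₁ := congrArg (fun t => a ⊗ₜ[F] t) (hm x b y)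
    have h₂ := congrArg (fun t => t ⊗ₜ[F] a) (hm x b y)
    simp only [tmul_sub, sub_tmul] at h₁ h₂
    linear_combination (norm := abel) h₁ - h₂
  | add r s hr hs =>
    simp only [map_add]
    linear_combination (norm := abel) hr + hs

end CoboundaryDelta

/-- for `Δ(x) = (id ⊗ L(x))r + (R(x) ⊗ id)σr`, condition (i) holds iff
`(L(x) ⊗ R(y) + R(x) ⊗ L(y))(r + σr) = 0` for all `x, y`, and condition (ii) holds
iff `(R(x) ⊗ R(y) − R(y) ⊗ R(x) + L(x) ⊗ L(y) − L(y) ⊗ L(x))(r + σr) = 0`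
for all `x, y`. -/
theorem coboundary_conditions_iff
    {F : Type*} [Field F] {A : Type*} [AddCommGroup A] [Module F A]
    (hchar : (2 : F) ≠ 0)
    (m : A →ₗ[F] A →ₗ[F] A) (hm : IsAntiFlexible m)
    (r : A ⊗[F] A) :
    (BialgCondI m (coboundaryDelta m r) ↔
      ∀ x y : A,
        ((TensorProduct.map (m x) (m.flip y) + TensorProduct.map (m.flip x) (m y) :
            A ⊗[F] A →ₗ[F] A ⊗[F] A))
          (r + TensorProduct.comm F A A r) = 0) ∧
    (BialgCondII m (coboundaryDelta m r) ↔
      ∀ x y : A,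
        ((TensorProduct.map (m.flip x) (m.flip y) - TensorProduct.map (m.flip y) (m.flip x)
            + TensorProduct.map (m x) (m y) - TensorProduct.map (m y) (m x) :
            A ⊗[F] A →ₗ[F] A ⊗[F] A))
          (r + TensorProduct.comm F A A r) = 0) := by
  constructor
  · rw [forall_comm]
    refine forall₂_congr fun y x => ?_
    rw [← coboundaryDelta_defect_condI hm, sub_eq_zero, eq_comm]
  · refine forall₂_congr fun x y => ?_
    rw [← coboundaryDelta_defect_condII hm, sub_eq_zero, eq_comm]
end

section
/- Let A be a finite-dimensional vector space over a field F of characteristic ≠ 2 and Δ : A → A⊗A a linear map. Then the dual map Δ* : A*⊗A* → A* defines an anti-flexible algebra structure on A* if and only if E_Δ = 0, where E_Δ = (Δ ⊗ id)Δ − (id ⊗ Δ)Δ + ((σΔ) ⊗ id)(σΔ) − (id ⊗ (σΔ))(σΔ) as a map A → A⊗A⊗A. -/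
open LinearMap Module TensorProduct

/-- `E_Δ = (Δ ⊗ id)Δ − (id ⊗ Δ)Δ + ((σΔ) ⊗ id)(σΔ) − (id ⊗ (σΔ))(σΔ)`, written in
`(A ⊗ A) ⊗ A` using the associator. -/
noncomputable def Edelta {F : Type*} [Field F] {A : Type*} [AddCommGroup A] [Module F A]
    (Δ : A →ₗ[F] A ⊗[F] A) : A →ₗ[F] (A ⊗[F] A) ⊗[F] A :=
  TensorProduct.map Δ LinearMap.id ∘ₗ Δ
    - (TensorProduct.assoc F A A A).symm.toLinearMap
        ∘ₗ TensorProduct.map LinearMap.id Δ ∘ₗ Δ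
    + TensorProduct.map ((TensorProduct.comm F A A).toLinearMap ∘ₗ Δ) LinearMap.id
        ∘ₗ (TensorProduct.comm F A A).toLinearMap ∘ₗ Δ
    - (TensorProduct.assoc F A A A).symm.toLinearMap
        ∘ₗ TensorProduct.map LinearMap.id ((TensorProduct.comm F A A).toLinearMap ∘ₗ Δ)
        ∘ₗ (TensorProduct.comm F A A).toLinearMap ∘ₗ Δ

namespace TensorProduct

variable {F : Type*} [Field F] {U V W X : Type*}
  [AddCommGroup U] [Module F U] [AddCommGroup V] [Module F V]
  [AddCommGroup W] [Module F W] [AddCommGroup X] [Module F X]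

theorem dualDistrib_tmul_map (f : Dual F W) (g : Dual F X) (h : U →ₗ[F] W) (k : V →ₗ[F] X)
    (t : U ⊗[F] V) :
    dualDistrib F W X (f ⊗ₜ g) (map h k t) = dualDistrib F U V ((f ∘ₗ h) ⊗ₜ (g ∘ₗ k)) t := by
  induction t with
  | zero => simp
  | tmul => simp
  | add s t hs ht => simp only [map_add, hs, ht]

theorem dualDistrib_tmul_comm (f : Dual F V) (g : Dual F U) (t : U ⊗[F] V) :
    dualDistrib F V U (f ⊗ₜ g) (TensorProduct.comm F U V t) = dualDistrib F U V (g ⊗ₜ f) t := by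
  induction t with
  | zero => simp
  | tmul => simp [mul_comm]
  | add s t hs ht => simp only [map_add, hs, ht]

theorem dualDistrib_tmul_assoc_symm (f : Dual F U) (g : Dual F V) (h : Dual F W)
    (t : U ⊗[F] (V ⊗[F] W)) :
    dualDistrib F (U ⊗[F] V) W (dualDistrib F U V (f ⊗ₜ g) ⊗ₜ h)
        ((TensorProduct.assoc F U V W).symm t) =
      dualDistrib F U (V ⊗[F] W) (f ⊗ₜ dualDistrib F V W (g ⊗ₜ h)) t := by
  induction t with
  | zero => simp
  | tmul u s =>
    induction s with
    | zero => simp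
    | tmul => simp [mul_assoc]
    | add s t hs ht => simp only [tmul_add, map_add, hs, ht]
  | add s t hs ht => simp only [map_add, hs, ht]

theorem eq_zero_of_dualDistrib_tmul_eq_zero [FiniteDimensional F U] [FiniteDimensional F V]
    {t : U ⊗[F] V} (ht : ∀ (f : Dual F U) (g : Dual F V), dualDistrib F U V (f ⊗ₜ g) t = 0) :
    t = 0 := by
  rw [← Module.forall_dual_apply_eq_zero_iff F]
  intro φ
  obtain ⟨s, rfl⟩ := (dualDistribEquiv F U V).surjective φ
  change dualDistrib F U V s t = 0
  induction s with
  | zero => simp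
  | tmul f g => exact ht f g
  | add s s' hs hs' => simp only [map_add, LinearMap.add_apply, hs, hs', add_zero]

theorem eq_zero_of_dualDistrib_tmul_tmul_eq_zero [FiniteDimensional F U] [FiniteDimensional F V]
    [FiniteDimensional F W] {t : (U ⊗[F] V) ⊗[F] W}
    (ht : ∀ (f : Dual F U) (g : Dual F V) (h : Dual F W),
      dualDistrib F (U ⊗[F] V) W (dualDistrib F U V (f ⊗ₜ g) ⊗ₜ h) t = 0) :
    t = 0 := by
  refine eq_zero_of_dualDistrib_tmul_eq_zero fun φ h => ?_
  obtain ⟨s, rfl⟩ := (dualDistribEquiv F U V).surjective φ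
  change dualDistrib F (U ⊗[F] V) W (dualDistrib F U V s ⊗ₜ h) t = 0
  induction s with
  | zero => simp
  | tmul f g => exact ht f g h
  | add s s' hs hs' => simp only [map_add, add_tmul, LinearMap.add_apply, hs, hs', add_zero]

end TensorProduct

section

variable {F : Type*} [Field F] {A : Type*} [AddCommGroup A] [Module F A]

theorem dualDistrib_tmul_comp (Δ : A →ₗ[F] A ⊗[F] A) (a b : Dual F A) :
    dualDistrib F A A (a ⊗ₜ b) ∘ₗ Δ = dualProd Δ a b := rfl

theorem dualProd_comm_comp (Δ : A →ₗ[F] A ⊗[F] A) (a b : Dual F A) :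
    dualProd ((TensorProduct.comm F A A).toLinearMap ∘ₗ Δ) a b = dualProd Δ b a :=
  LinearMap.ext fun x => dualDistrib_tmul_comm a b (Δ x)

theorem dualDistrib_tmul_apply (Δ : A →ₗ[F] A ⊗[F] A) (a b : Dual F A) (x : A) :
    dualDistrib F A A (a ⊗ₜ b) (Δ x) = dualProd Δ a b x := rfl

theorem dualDistrib_Edelta (Δ : A →ₗ[F] A ⊗[F] A) (a b c : Dual F A) (x : A) :
    dualDistrib F (A ⊗[F] A) A (dualDistrib F A A (a ⊗ₜ b) ⊗ₜ c) (Edelta Δ x) =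
      dualProd Δ (dualProd Δ a b) c x - dualProd Δ a (dualProd Δ b c) x
        + dualProd Δ c (dualProd Δ b a) x - dualProd Δ (dualProd Δ c b) a x := by
  simp only [Edelta, LinearMap.sub_apply, LinearMap.add_apply, LinearMap.comp_apply,
    LinearEquiv.coe_coe, map_sub, map_add, dualDistrib_tmul_assoc_symm, dualDistrib_tmul_map,
    dualDistrib_tmul_comp, dualProd_comm_comp, LinearMap.comp_id,
    dualDistrib_tmul_comm, dualDistrib_tmul_apply]

end

/-- `Δ* : A* ⊗ A* → A*` defines an anti-flexible algebra structure on
`A*` if and only if `E_Δ = 0`. -/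
theorem dual_antiFlexible_iff_Edelta_eq_zero
    {F : Type*} [Field F] {A : Type*} [AddCommGroup A] [Module F A]
    [FiniteDimensional F A]
    (hchar : (2 : F) ≠ 0)
    (Δ : A →ₗ[F] A ⊗[F] A) :
    IsAntiFlexible (dualProd Δ) ↔ Edelta Δ = 0 := by
  constructor
  · intro h
    refine LinearMap.ext fun x => eq_zero_of_dualDistrib_tmul_tmul_eq_zero fun a b c => ?_
    have key := LinearMap.congr_fun (h a b c) x
    simp only [LinearMap.sub_apply] at key
    rw [dualDistrib_Edelta]
    linear_combination key
  · intro h a b c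
    ext x
    have key := dualDistrib_Edelta Δ a b c x
    rw [h, LinearMap.zero_apply, map_zero] at key
    simp only [LinearMap.sub_apply]
    linear_combination -key
end

section
/- Let (A, ·) be a finite-dimensional anti-flexible algebra over a field F of characteristic ≠ 2 and let r ∈ A⊗A be skew-symmetric (σr = −r). Regard r as a linear map A* → A via ⟨r(u*), v*⟩ = ⟨r, u*⊗v*⟩. Then r is a solution of the anti-flexible Yang–Baxter equation if and only if r(a)·r(b) = r(R_·*(r(a))b + L_·*(r(b))a) for all a, b ∈ A*. -/
open LinearMap Module TensorProduct

variable {F : Type*} [Field F] {A : Type*} [AddCommGroup A] [Module F A]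

noncomputable def mulMap (m : A →ₗ[F] A →ₗ[F] A) : A ⊗[F] A →ₗ[F] A :=
  TensorProduct.lift m

noncomputable def prod1213 (m : A →ₗ[F] A →ₗ[F] A) :
    (A ⊗[F] A) ⊗[F] (A ⊗[F] A) →ₗ[F] (A ⊗[F] A) ⊗[F] A :=
  (TensorProduct.assoc F A A A).symm.toLinearMap
    ∘ₗ TensorProduct.map (mulMap m) LinearMap.id
    ∘ₗ (tensorTensorTensorComm F A A A A).toLinearMap

noncomputable def prod1323 (m : A →ₗ[F] A →ₗ[F] A) :
    (A ⊗[F] A) ⊗[F] (A ⊗[F] A) →ₗ[F] (A ⊗[F] A) ⊗[F] A :=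
  TensorProduct.map LinearMap.id (mulMap m)
    ∘ₗ (tensorTensorTensorComm F A A A A).toLinearMap

noncomputable def prod2312 (m : A →ₗ[F] A →ₗ[F] A) :
    (A ⊗[F] A) ⊗[F] (A ⊗[F] A) →ₗ[F] (A ⊗[F] A) ⊗[F] A :=
  TensorProduct.map
      (TensorProduct.map LinearMap.id (mulMap m) ∘ₗ (TensorProduct.assoc F A A A).toLinearMap)
      LinearMap.id
    ∘ₗ (TensorProduct.assoc F (A ⊗[F] A) A A).symm.toLinearMap
    ∘ₗ (tensorTensorTensorComm F A A A A).toLinearMap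
    ∘ₗ (TensorProduct.comm F (A ⊗[F] A) (A ⊗[F] A)).toLinearMap

/-- The anti-flexible Yang–Baxter equation `r₁₂·r₁₃ − r₂₃·r₁₂ + r₁₃·r₂₃ = 0`. -/
def IsAFYBESolution (m : A →ₗ[F] A →ₗ[F] A) (r : A ⊗[F] A) : Prop :=
  prod1213 m (r ⊗ₜ[F] r) - prod2312 m (r ⊗ₜ[F] r) + prod1323 m (r ⊗ₜ[F] r) = 0

/-- An element `r ∈ A ⊗ A` regarded as a linear map `A* → A`:
`⟨r(u*), v*⟩ = ⟨r, u* ⊗ v*⟩`. -/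
noncomputable def tensorToMap (r : A ⊗[F] A) : Dual F A →ₗ[F] A :=
  dualTensorHom F (Dual F A) A
    (TensorProduct.map (Module.Dual.eval F A) LinearMap.id r)

theorem tensorToMap_tmul (x y : A) (u : Dual F A) :
    tensorToMap (x ⊗ₜ[F] y) u = u x • y := by
  simp [tensorToMap]

theorem tensorToMap_add (s t : A ⊗[F] A) : tensorToMap (s + t) = tensorToMap s + tensorToMap t := by
  simp [tensorToMap]

theorem tensorToMap_neg (s : A ⊗[F] A) : tensorToMap (-s) = -tensorToMap s := by
  simp [tensorToMap]

theorem tensorToMap_zero : tensorToMap (0 : A ⊗[F] A) = 0 := by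
  simp [tensorToMap]

/-- The functional `u ⊗ v ⊗ w` on `A ⊗ A ⊗ A`. -/
noncomputable def tripleEval (u v w : Dual F A) : (A ⊗[F] A) ⊗[F] A →ₗ[F] F :=
  LinearMap.mul' F F ∘ₗ TensorProduct.map (LinearMap.mul' F F ∘ₗ TensorProduct.map u v) w

theorem tripleEval_tmul (u v w : Dual F A) (x y z : A) :
    tripleEval u v w ((x ⊗ₜ y) ⊗ₜ z) = u x * v y * w z := by
  simp [tripleEval]

theorem eq_zero_of_tripleEval_eq_zero [FiniteDimensional F A] {t : (A ⊗[F] A) ⊗[F] A}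
    (h : ∀ u v w : Dual F A, tripleEval u v w t = 0) : t = 0 := by
  let b := Module.finBasis F A
  refine ((b.tensorProduct b).tensorProduct b).ext_elem fun ⟨⟨i, j⟩, k⟩ => ?_
  have key : ((b.tensorProduct b).tensorProduct b).coord ((i, j), k) =
      tripleEval (b.coord i) (b.coord j) (b.coord k) := by
    ext x y z
    simp [tripleEval_tmul, mul_comm, mul_left_comm]
  simpa [← key] using h (b.coord i) (b.coord j) (b.coord k)

theorem tripleEval_prod1213 (m : A →ₗ[F] A →ₗ[F] A) (u v w : Dual F A) (s t : A ⊗[F] A) :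
    tripleEval u v w (prod1213 m (s ⊗ₜ t)) =
      u (m (tensorToMap (TensorProduct.comm F A A s) v)
        (tensorToMap (TensorProduct.comm F A A t) w)) := by
  induction s with
  | zero => simp [tensorToMap_zero]
  | add s₁ s₂ h₁ h₂ => simp [add_tmul, tensorToMap_add, h₁, h₂]
  | tmul x y =>
    induction t with
    | zero => simp [tensorToMap_zero]
    | add t₁ t₂ h₁ h₂ => simp only [tmul_add, tensorToMap_add, h₁, h₂, map_add, LinearMap.add_apply]
    | tmul z w' =>
      simp [prod1213, mulMap, tripleEval_tmul, tensorToMap_tmul]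
      ring

theorem tripleEval_prod2312 (m : A →ₗ[F] A →ₗ[F] A) (u v w : Dual F A) (s t : A ⊗[F] A) :
    tripleEval u v w (prod2312 m (s ⊗ₜ t)) =
      v (m (tensorToMap (TensorProduct.comm F A A s) w) (tensorToMap t u)) := by
  induction s with
  | zero => simp [tensorToMap_zero]
  | add s₁ s₂ h₁ h₂ => simp [add_tmul, tensorToMap_add, h₁, h₂]
  | tmul x y =>
    induction t with
    | zero => simp [tensorToMap_zero]
    | add t₁ t₂ h₁ h₂ => simp only [tmul_add, tensorToMap_add, h₁, h₂, map_add, LinearMap.add_apply]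
    | tmul z w' =>
      simp [prod2312, mulMap, tripleEval_tmul, tensorToMap_tmul]
      ring

theorem tripleEval_prod1323 (m : A →ₗ[F] A →ₗ[F] A) (u v w : Dual F A) (s t : A ⊗[F] A) :
    tripleEval u v w (prod1323 m (s ⊗ₜ t)) =
      w (m (tensorToMap s u) (tensorToMap t v)) := by
  induction s with
  | zero => simp [tensorToMap_zero]
  | add s₁ s₂ h₁ h₂ => simp [add_tmul, tensorToMap_add, h₁, h₂]
  | tmul x y =>
    induction t with
    | zero => simp [tensorToMap_zero]
    | add t₁ t₂ h₁ h₂ => simp only [tmul_add, tensorToMap_add, h₁, h₂, map_add, LinearMap.add_apply]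
    | tmul z w' =>
      simp [prod1323, mulMap, tripleEval_tmul, tensorToMap_tmul]
      ring

theorem apply_tensorToMap_comm (s : A ⊗[F] A) (u v : Dual F A) :
    v (tensorToMap (TensorProduct.comm F A A s) u) = u (tensorToMap s v) := by
  induction s with
  | zero => simp [tensorToMap_zero]
  | add s₁ s₂ h₁ h₂ => simp [tensorToMap_add, h₁, h₂]
  | tmul x y => simp [tensorToMap_tmul, mul_comm]

/-- For skew-symmetric `r`, the AFYBE is a cyclic identity for the operator attached to `r`. -/
theorem isAFYBESolution_iff_cyclic [FiniteDimensional F A] (m : A →ₗ[F] A →ₗ[F] A)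
    (r : A ⊗[F] A) (hskew : TensorProduct.comm F A A r = -r) :
    IsAFYBESolution m r ↔ ∀ u v w : Dual F A,
      u (m (tensorToMap r v) (tensorToMap r w)) + v (m (tensorToMap r w) (tensorToMap r u)) +
        w (m (tensorToMap r u) (tensorToMap r v)) = 0 := by
  have eval_eq (u v w : Dual F A) :
      tripleEval u v w
          (prod1213 m (r ⊗ₜ[F] r) - prod2312 m (r ⊗ₜ[F] r) + prod1323 m (r ⊗ₜ[F] r)) =
        u (m (tensorToMap r v) (tensorToMap r w)) + v (m (tensorToMap r w) (tensorToMap r u)) +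
          w (m (tensorToMap r u) (tensorToMap r v)) := by
    rw [map_add, map_sub, tripleEval_prod1213, tripleEval_prod2312, tripleEval_prod1323, hskew,
      tensorToMap_neg]
    simp
  refine ⟨fun h u v w => ?_, fun h => eq_zero_of_tripleEval_eq_zero fun u v w => ?_⟩
  · rw [← eval_eq, h, map_zero]
  · rw [eval_eq, h]

/-- a skew-symmetric `r` is a solution of the anti-flexible Yang–Baxter
equation iff `r(a)·r(b) = r(R_·*(r(a))b + L_·*(r(b))a)` for all `a, b ∈ A*`. -/
theorem afybe_iff_operator_form [FiniteDimensional F A]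
    (hchar : (2 : F) ≠ 0)
    (m : A →ₗ[F] A →ₗ[F] A) (hm : IsAntiFlexible m)
    (r : A ⊗[F] A) (hskew : TensorProduct.comm F A A r = -r) :
    IsAFYBESolution m r ↔
      ∀ a b : Dual F A,
        m (tensorToMap r a) (tensorToMap r b) =
          tensorToMap r
            ((m.flip (tensorToMap r a)).dualMap b + (m (tensorToMap r b)).dualMap a) := by
  have skew (u v : Dual F A) : v (tensorToMap r u) = -u (tensorToMap r v) := by
    rw [← apply_tensorToMap_comm, hskew, tensorToMap_neg]
    simp
  rw [isAFYBESolution_iff_cyclic m r hskew]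
  have pairing (u v w : Dual F A) :
      w (tensorToMap r
          ((m.flip (tensorToMap r u)).dualMap v + (m (tensorToMap r v)).dualMap u)) =
        -(u (m (tensorToMap r v) (tensorToMap r w)) +
          v (m (tensorToMap r w) (tensorToMap r u))) := by
    rw [skew]
    simp [add_comm]
  refine ⟨fun h a b => ?_, fun h u v w => ?_⟩
  · rw [← sub_eq_zero, ← Module.forall_dual_apply_eq_zero_iff F]
    intro w
    rw [map_sub, pairing]
    linear_combination h a b w
  · rw [h u v, pairing]
    ring
end

section
/- Let (A, ≺, ≻) be a pre-anti-flexible algebra over a field F of characteristic ≠ 2. Define x∗y = x≺y + x≻y. Then (A, ∗) is an anti-flexible algebra (the associated anti-flexible algebra of (A, ≺, ≻)). -/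
open LinearMap

/-- A pre-anti-flexible algebra: two bilinear products `≺` (`p`) and `≻` (`s`) with
`(x,y,z)ₘ = (z,y,x)ₘ` and `(x,y,z)ₗ = (z,y,x)ᵣ`, where `x∗y = x≺y + x≻y`. -/
def IsPreAntiFlexible {F : Type*} [Field F] {A : Type*} [AddCommGroup A] [Module F A]
    (p s : A →ₗ[F] A →ₗ[F] A) : Prop :=
  (∀ x y z : A, p (s x y) z - s x (p y z) = p (s z y) x - s z (p y x)) ∧
  (∀ x y z : A,
    s (p x y + s x y) z - s x (s y z) = p (p z y) x - p z (p y x + s y x))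

/-- for a pre-anti-flexible algebra `(A, ≺, ≻)`, the product
`x∗y = x≺y + x≻y` makes `A` an anti-flexible algebra. -/
theorem preAntiFlexible_gives_antiFlexible
    {F : Type*} [Field F] {A : Type*} [AddCommGroup A] [Module F A]
    (hchar : (2 : F) ≠ 0)
    (p s : A →ₗ[F] A →ₗ[F] A) (hps : IsPreAntiFlexible p s) :
    IsAntiFlexible (p + s) := by
  obtain ⟨hm, hlr⟩ := hps
  intro x y z
  have h₁ := hm x y z
  have h₂ := hlr x y z
  have h₃ := hlr z y x
  simp only [LinearMap.add_apply, map_add] at h₁ h₂ h₃ ⊢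
  linear_combination (norm := abel) h₁ + h₂ - h₃
end

section
/- Let (l, r, V) be a bimodule of an anti-flexible algebra (A, ·) over a field F of characteristic ≠ 2 and let T : V → A be an 𝒪-operator associated to (l, r, V). Then the products u≻v = l(T(u))v and u≺v = r(T(v))u define a pre-anti-flexible algebra structure on V, and T is a homomorphism from the associated anti-flexible algebra (V, ∗) (where u∗v = u≺v + u≻v) to (A, ·), i.e., T(u∗v) = T(u)·T(v) for all u, v ∈ V. -/
open LinearMap

/-- an `𝒪`-operator `T : V → A` associated to a bimodule `(l, r, V)`
of an anti-flexible algebra `(A, ·)` induces a pre-anti-flexible structure on `V`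
by `u ≻ v = l(T(u))v` and `u ≺ v = r(T(v))u`, and `T` is a homomorphism from the
associated anti-flexible algebra `(V, ∗)` to `(A, ·)`. -/
theorem oOperator_gives_preAntiFlexible
    {F : Type*} [Field F] {A : Type*} [AddCommGroup A] [Module F A]
    {V : Type*} [AddCommGroup V] [Module F V]
    (hchar : (2 : F) ≠ 0)
    (m : A →ₗ[F] A →ₗ[F] A) (hm : IsAntiFlexible m)
    (l r : A →ₗ[F] V →ₗ[F] V) (hlr : IsAntiFlexibleBimodule m l r)
    (T : V →ₗ[F] A)
    (hT : ∀ u v : V, m (T u) (T v) = T (l (T u) v + r (T v) u)) :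
    IsPreAntiFlexible ((r ∘ₗ T).flip) (l ∘ₗ T) ∧
      ∀ u v : V,
        T ((r ∘ₗ T).flip u v + (l ∘ₗ T) u v) = m (T u) (T v) := by
  have hom : ∀ u v : V, T (r (T v) u + l (T u) v) = m (T u) (T v) := fun u v => by
    rw [hT, add_comm]
  refine ⟨⟨fun x y z => ?_, fun x y z => ?_⟩, hom⟩
  · have h := LinearMap.congr_fun (hlr.2 (T x) (T z)) y
    simp only [LinearMap.sub_apply, comp_apply, flip_apply] at h ⊢
    rw [← neg_sub, h, neg_sub]
  · have h := LinearMap.congr_fun (hlr.1 (T x) (T y)) z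
    simp only [LinearMap.sub_apply, comp_apply, flip_apply] at h ⊢
    rw [hom, hom, h]
end

section
/- Let (A, ·) be an anti-flexible algebra over a field F of characteristic ≠ 2. Then there exists a pre-anti-flexible algebra structure (≺, ≻) on A whose associated anti-flexible algebra is (A, ·) (i.e., x≺y + x≻y = x·y for all x, y ∈ A) if and only if there exist a bimodule (l, r, V) of (A, ·) and an invertible 𝒪-operator T : V → A associated to (l, r, V). -/
open LinearMap

/-- The data of a bimodule of `(A, m)` together with a linear map `T` into `A`. -/
structure BimoduleMapData (F : Type*) [Field F] (A : Type u) [AddCommGroup A] [Module F A]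
    (m : A →ₗ[F] A →ₗ[F] A) where
  V : Type u
  [instAdd : AddCommGroup V]
  [instMod : Module F V]
  l : A →ₗ[F] V →ₗ[F] V
  r : A →ₗ[F] V →ₗ[F] V
  T : V →ₗ[F] A
  isBimodule : IsAntiFlexibleBimodule m l r

attribute [instance] BimoduleMapData.instAdd BimoduleMapData.instMod

/-- an anti-flexible algebra `(A, ·)` carries a compatible
pre-anti-flexible structure (with `x≺y + x≻y = x·y`) if and only if there is an
invertible `𝒪`-operator `T : V → A` associated to some bimodule `(l, r, V)`. -/
theorem compatible_preAntiFlexible_iff_invertible_oOperator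
    {F : Type*} [Field F] {A : Type*} [AddCommGroup A] [Module F A]
    (hchar : (2 : F) ≠ 0)
    (m : A →ₗ[F] A →ₗ[F] A) (hm : IsAntiFlexible m) :
    (∃ p s : A →ₗ[F] A →ₗ[F] A,
        IsPreAntiFlexible p s ∧ ∀ x y : A, p x y + s x y = m x y) ↔
      (∃ d : BimoduleMapData F A m,
        Function.Bijective d.T ∧
          ∀ u v : d.V, m (d.T u) (d.T v) = d.T (d.l (d.T u) v + d.r (d.T v) u)) := by
  constructor
  · rintro ⟨p, s, ⟨h₁, h₂⟩, h⟩
    refine ⟨{ V := A, l := s, r := p.flip, T := LinearMap.id, isBimodule := ⟨?_, ?_⟩ },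
      Function.bijective_id, ?_⟩
    · intro x y
      ext z
      simpa [h] using h₂ x y z
    · intro x y
      ext z
      have := congrArg Neg.neg (h₁ x z y)
      simpa using this
    · intro u v
      change m u v = s u v + p u v
      rw [← h, add_comm]
  · rintro ⟨⟨V, l, r, T, hb₁, hb₂⟩, hT, hO⟩
    dsimp only at hT hO
    let e : V ≃ₗ[F] A := LinearEquiv.ofBijective T hT
    have he (x : A) : T (e.symm x) = x := e.apply_symm_apply x
    have he' (v : V) : e.symm (T v) = v := e.symm_apply_apply v
    let s : A →ₗ[F] A →ₗ[F] A := l.compr₂ T |>.compl₂ e.symm.toLinearMap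
    let p : A →ₗ[F] A →ₗ[F] A := (r.compr₂ T |>.compl₂ e.symm.toLinearMap).flip
    have hs (x y : A) : s x y = T (l x (e.symm y)) := rfl
    have hp (x y : A) : p x y = T (r y (e.symm x)) := rfl
    have h (x y : A) : p x y + s x y = m x y := by
      have := hO (e.symm x) (e.symm y)
      rw [he, he] at this
      rw [this, hs, hp, map_add, add_comm]
    refine ⟨p, s, ⟨fun x y z ↦ ?_, fun x y z ↦ ?_⟩, h⟩
    · have := congrArg (fun f ↦ -T (f (e.symm y))) (hb₂ x z)
      simpa [hs, hp, he'] using this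
    · have := congrArg (fun f ↦ T (f (e.symm z))) (hb₁ x y)
      rw [h, h]
      simpa [hs, hp, he'] using this
end
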